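/- arXiv:1310.8157 — 6 statements merged into one kernel-verified Lean document; each statement's English description precedes it below -/
import Mathlib

section
/- Let S be a cyclic separation relation on a set X. Then for all pairwise distinct α, β, γ, δ, ε ∈ X, if S(α,β;γ,δ) holds then exactly one of S(α,β;γ,ε) and S(α,β;δ,ε) holds. -/
/-- `S` is a cyclic separation relation on `X`. -/
def IsCyclicSeparation {X : Type*} (S : X → X → X → X → Prop) : Prop :=
  (∀ a b c d : X, S a b c d → S b a c d ∧ S c d a b) ∧
  (∀ a b c d : X, (S a b c d ∧ S a c b d) ↔ (b = c ∨ a = d)) ∧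
  (∀ a b c d e : X, S a b c d → S a b c e ∨ S a b d e) ∧
  (∀ a b c d : X, S a b c d ∨ S a c d b ∨ S a d b c)

namespace IsCyclicSeparation

variable {X : Type*} {S : X → X → X → X → Prop} {a b c d e : X}

theorem swap_left (hS : IsCyclicSeparation S) (h : S a b c d) : S b a c d :=
  (hS.1 a b c d h).1

theorem swap_pairs (hS : IsCyclicSeparation S) (h : S a b c d) : S c d a b :=
  (hS.1 a b c d h).2

theorem swap_right (hS : IsCyclicSeparation S) (h : S a b c d) : S a b d c :=
  hS.swap_pairs (hS.swap_left (hS.swap_pairs h))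

/-- Two different pairings of the same four points cannot both be separating. -/
theorem not_exchange (hS : IsCyclicSeparation S) (hbc : b ≠ c) (had : a ≠ d)
    (h : S a b c d) : ¬ S a c b d :=
  fun h' => ((hS.2.1 a b c d).1 ⟨h, h'⟩).elim hbc had

/-- If `a, b` separate `c, d`, then they separate one of `c`, `d` from any further point. -/
theorem extend (hS : IsCyclicSeparation S) (e : X) (h : S a b c d) :
    S a b c e ∨ S a b d e :=
  hS.2.2.1 a b c d e h

/-- A pair of points cannot separate each two of three further points. -/
theorem not_all_separated (hS : IsCyclicSeparation S)
    (hac : a ≠ c) (had : a ≠ d) (hae : a ≠ e) (hbc : b ≠ c) (hbd : b ≠ d) (hbe : b ≠ e)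
    (hcd : c ≠ d) (hce : c ≠ e) (hde : d ≠ e)
    (h₁ : S a b c d) (h₂ : S a b c e) : ¬ S a b d e := by
  intro h₃
  have unique : ∀ x, x ≠ c → x ≠ d → x ≠ e →
      ¬ (S c d x e ∧ S c e x d) ∧ ¬ (S c d x e ∧ S d e x c) ∧
        ¬ (S c e x d ∧ S d e x c) := by
    intro x hxc hxd hxe
    refine ⟨fun ⟨h, h'⟩ => ?_, fun ⟨h, h'⟩ => ?_, fun ⟨h, h'⟩ => ?_⟩
    · exact hS.not_exchange hde hxc.symm (hS.swap_right h) (hS.swap_right h')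
    · exact hS.not_exchange hce hxd.symm (hS.swap_left (hS.swap_right h)) (hS.swap_right h')
    · exact hS.not_exchange hcd hxe.symm (hS.swap_left (hS.swap_right h))
        (hS.swap_left (hS.swap_right h'))
  have ha := unique a hac had hae
  have hb := unique b hbc hbd hbe
  have k₁ := hS.extend e (hS.swap_pairs h₁)
  have k₂ := hS.extend d (hS.swap_pairs h₂)
  have k₃ := hS.extend c (hS.swap_pairs h₃)
  tauto

end IsCyclicSeparation

/-- For a cyclic separation relation and pairwise distinct `α, β, γ, δ, ε`,
if `S(α,β;γ,δ)` holds then exactly one of `S(α,β;γ,ε)`, `S(α,β;δ,ε)` holds. -/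
theorem cyclic_separation_exactly_one {X : Type*} (S : X → X → X → X → Prop)
    (hS : IsCyclicSeparation S) :
    ∀ a b c d e : X,
      a ≠ b → a ≠ c → a ≠ d → a ≠ e → b ≠ c → b ≠ d → b ≠ e →
      c ≠ d → c ≠ e → d ≠ e →
      S a b c d → Xor' (S a b c e) (S a b d e) := by
  intro a b c d e _ hac had hae hbc hbd hbe hcd hce hde h
  rcases hS.extend e h with h' | h'
  · exact Or.inl ⟨h', hS.not_all_separated hac had hae hbc hbd hbe hcd hce hde h h'⟩
  · exact Or.inr ⟨h', fun h'' =>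
      hS.not_all_separated hac had hae hbc hbd hbe hcd hce hde h h'' h'⟩
end

section
/- Let S be a cyclic separation relation on a set X. Then for all pairwise distinct α, β, γ, δ, δ' ∈ X: if S(α,β;γ,δ) and S(α,β;γ,δ') both hold, then S(α,δ;β,δ') or S(α,δ';β,δ) holds. -/
/-- Property (s5): for a cyclic separation relation and pairwise distinct
`α, β, γ, δ, δ'`, if `S(α,β;γ,δ)` and `S(α,β;γ,δ')` hold then
`S(α,δ;β,δ')` or `S(α,δ';β,δ)` holds. -/
theorem cyclic_separation_s5 {X : Type*} (S : X → X → X → X → Prop)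
    (hS : IsCyclicSeparation S) :
    ∀ a b c d d' : X,
      a ≠ b → a ≠ c → a ≠ d → a ≠ d' → b ≠ c → b ≠ d → b ≠ d' →
      c ≠ d → c ≠ d' → d ≠ d' →
      S a b c d → S a b c d' → S a d b d' ∨ S a d' b d := by
  obtain ⟨h1, h2, h3, h4⟩ := hS
  intro a b c d d' hab hac had had' hbc hbd hbd' hcd hcd' hdd' h h'
  have left {w x y z : X} (k : S w x y z) : S x w y z := (h1 _ _ _ _ k).1
  have swap {w x y z : X} (k : S w x y z) : S y z w x := (h1 _ _ _ _ k).2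
  have right {w x y z : X} (k : S w x y z) : S w x z y := swap (left (swap k))
  have excl {w x y z : X} (hxy : x ≠ y) (hwz : w ≠ z) (k : S w x y z) : ¬ S w y x z :=
    fun l => ((h2 w x y z).1 ⟨k, l⟩).elim hxy hwz
  -- For each `x`, at most one of these facts holds, whereas (s3) yields all three, each with
  -- `x` one of `a` and `b`, unless one of the alternatives in the goal holds.
  have clash (x : X) (hxc : x ≠ c) (hxd : x ≠ d) (hxd' : x ≠ d') :
      ¬ (S c d x d' ∧ S c d' x d) ∧ ¬ (S c d x d' ∧ S d d' x c) ∧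
        ¬ (S c d' x d ∧ S d d' x c) :=
    ⟨fun k => excl hdd' hxc.symm (right k.1) (right k.2),
      fun k => excl hcd' hxd.symm (left (right k.1)) (right k.2),
      fun k => excl hcd hxd'.symm (left (right k.1)) (left (right k.2))⟩
  rcases h4 a b d d' with k | k | k
  · have p := h3 _ _ _ _ d' (swap h)
    have q := h3 _ _ _ _ d (swap h')
    have r := h3 _ _ _ _ c (swap k)
    have ka := clash a hac had had'
    have kb := clash b hbc hbd hbd'
    tauto
  · exact Or.inl (right k)
  · exact Or.inr k
end

section
/- Let D be a D-relation on a set X. Then for all pairwise distinct α, β, γ, δ, δ' ∈ X: if D(α,β;γ,δ) and D(α,β;γ,δ') both hold, then D(α,β;δ,δ') holds. -/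
/-- `D` is a D-relation on `X`. -/
def IsDRelation {X : Type*} (D : X → X → X → X → Prop) : Prop :=
  (∀ a b c d : X, D a b c d → D b a c d ∧ D c d a b) ∧
  (∀ a b c d : X, D a b c d → ¬ D a c b d) ∧
  (∀ a b c d e : X, D a b c d → D e b c d ∨ D a b c e) ∧
  (∀ a b c : X, a ≠ c → b ≠ c → D a b c c) ∧
  (∀ a b c : X, a ≠ b → a ≠ c → b ≠ c → ∃ d, c ≠ d ∧ D a b c d)

/-- Property (d6): for a D-relation and pairwise distinct `α, β, γ, δ, δ'`,
if `D(α,β;γ,δ)` and `D(α,β;γ,δ')` hold then `D(α,β;δ,δ')` holds. -/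
theorem d_relation_d6 {X : Type*} (D : X → X → X → X → Prop)
    (hD : IsDRelation D) :
    ∀ a b c d d' : X,
      a ≠ b → a ≠ c → a ≠ d → a ≠ d' → b ≠ c → b ≠ d → b ≠ d' →
      c ≠ d → c ≠ d' → d ≠ d' →
      D a b c d → D a b c d' → D a b d d' := by
  obtain ⟨symm, excl, subst, -, -⟩ := hD
  have swap_left {p q r s : X} (h : D p q r s) : D q p r s := (symm _ _ _ _ h).1
  have swap_pairs {p q r s : X} (h : D p q r s) : D r s p q := (symm _ _ _ _ h).2
  have swap_right {p q r s : X} (h : D p q r s) : D p q s r :=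
    swap_pairs (swap_left (swap_pairs h))
  intro a b c d d' _ _ _ _ _ _ _ _ _ _ h h'
  rcases subst a b d c d' (swap_right h) with h₁ | h₁
  · rcases subst a b d' c d (swap_right h') with h₂ | h₂
    · exact (excl b d' d c (swap_left h₁) (swap_left h₂)).elim
    · exact swap_right h₂
  · exact h₁
end

section
/- Let n ≥ 2 and k ≥ 2, and let (ℚ^n, B) be a Steiner k-system preserved by AGL_n(ℚ). If a_1, …, a_k are pairwise distinct points of ℚ^n all contained in an affine subspace A of ℚ^n with A ≠ ℚ^n, then every block of B containing all of a_1, …, a_k is contained in A. -/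
/-- `σ` is an element of `AGL_n(ℚ)`: a permutation of `ℚ^n` of the form
`x ↦ T x + b` with `T` an invertible `ℚ`-linear map and `b ∈ ℚ^n`. -/
def IsAGL (n : ℕ) (σ : Equiv.Perm (Fin n → ℚ)) : Prop :=
  ∃ T : (Fin n → ℚ) ≃ₗ[ℚ] (Fin n → ℚ), ∃ b : Fin n → ℚ, ∀ x, σ x = T x + b

/-- `(X, B)` is a Steiner `k`-system: all blocks have the same cardinality,
every block has more than `k` elements, there is more than one block, and any
`k` pairwise distinct points lie in a unique block. -/
def IsSteinerSystem {X : Type*} (k : ℕ) (B : Set (Set X)) : Prop :=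
  (∀ b₁ ∈ B, ∀ b₂ ∈ B, Cardinal.mk b₁ = Cardinal.mk b₂) ∧
  (∀ b ∈ B, (k : Cardinal) < Cardinal.mk b) ∧
  (∃ b₁ ∈ B, ∃ b₂ ∈ B, b₁ ≠ b₂) ∧
  (∀ f : Fin k → X, Function.Injective f → ∃! b, b ∈ B ∧ ∀ i, f i ∈ b)

theorem IsSteinerSystem.eq_of_common_points {X : Type*} {k : ℕ} {B : Set (Set X)}
    (hB : IsSteinerSystem k B) {b₁ b₂ : Set X} (h₁ : b₁ ∈ B) (h₂ : b₂ ∈ B)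
    {f : Fin k → X} (hf : Function.Injective f) (hf₁ : ∀ i, f i ∈ b₁) (hf₂ : ∀ i, f i ∈ b₂) :
    b₁ = b₂ :=
  (hB.2.2.2 f hf).unique ⟨h₁, hf₁⟩ ⟨h₂, hf₂⟩

theorem IsSteinerSystem.ne_univ.{u} {X : Type u} {k : ℕ} {B : Set (Set X)}
    (hB : IsSteinerSystem k B) {b : Set X} (hb : b ∈ B) : b ≠ Set.univ := by
  rintro rfl
  have key : ∀ b' ∈ B, Set.univ = b' := by
    intro b' hb'
    have hle : Cardinal.lift.{u} (Cardinal.mk (Fin k)) ≤ Cardinal.lift.{0} (Cardinal.mk b') := by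
      simpa using (hB.2.1 b' hb').le
    obtain ⟨g⟩ := Cardinal.lift_mk_le'.mp hle
    exact hB.eq_of_common_points hb hb' (Subtype.val_injective.comp g.injective)
      (fun _ => Set.mem_univ _) (fun i => (g i).2)
  obtain ⟨b₁, h₁, b₂, h₂, hne⟩ := hB.2.2.1
  exact hne ((key b₁ h₁).symm.trans (key b₂ h₂))

/-- A linear automorphism fixing the kernel of `f` pointwise and mapping `u` to `w`. -/
theorem exists_linearEquiv_fixing_ker {K V : Type*} [Field K] [AddCommGroup V] [Module K V]
    [FiniteDimensional K V] (f : V →ₗ[K] K) {u w : V} (hu : f u ≠ 0) (hw : f w ≠ 0) :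
    ∃ T : V ≃ₗ[K] V, (∀ x, f x = 0 → T x = x) ∧ T u = w := by
  let L : V →ₗ[K] V := LinearMap.id + f.smulRight ((f u)⁻¹ • (w - u))
  have hL : ∀ x, L x = x + f x • ((f u)⁻¹ • (w - u)) := fun x => rfl
  have hinj : Function.Injective L := by
    rw [injective_iff_map_eq_zero]
    intro x hx
    rw [hL] at hx
    have hfx : f x = 0 := by
      have h := congrArg f hx
      simp only [map_add, map_smul, map_sub, map_zero, smul_eq_mul] at h
      field_simp at h
      have h' : f x * f w = 0 := by linear_combination h
      exact (mul_eq_zero.mp h').resolve_right hw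
    simpa [hfx] using hx
  refine ⟨LinearEquiv.ofInjectiveEndo L hinj, fun x hx => ?_, ?_⟩
  · simp [hL, hx]
  · simp [hL, smul_smul, hu]

/-- If `AGL_n(ℚ)` preserves a Steiner `k`-system on `ℚ^n` and `a₁, …, a_k` are
distinct points lying in a proper affine subspace `A`, then every block containing
them is contained in `A`. -/
theorem steiner_block_subset_affine_subspace (n k : ℕ) (hn : 2 ≤ n) (hk : 2 ≤ k)
    (B : Set (Set (Fin n → ℚ))) (hB : IsSteinerSystem k B)
    (hpres : ∀ σ : Equiv.Perm (Fin n → ℚ), IsAGL n σ → ∀ b ∈ B, σ '' b ∈ B)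
    (A : AffineSubspace ℚ (Fin n → ℚ)) (hA : A ≠ ⊤)
    (a : Fin k → (Fin n → ℚ)) (ha : Function.Injective a) (haA : ∀ i, a i ∈ A)
    (b : Set (Fin n → ℚ)) (hb : b ∈ B) (hab : ∀ i, a i ∈ b) :
    b ⊆ (A : Set (Fin n → ℚ)) := by
  intro c hc
  by_contra hcA
  have hp₀ : a ⟨0, by omega⟩ ∈ A := haA _
  set p₀ := a ⟨0, by omega⟩
  have hcV : c - p₀ ∉ A.direction := fun h =>
    hcA ((AffineSubspace.vsub_right_mem_direction_iff_mem hp₀ c).mp h)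
  obtain ⟨f, hfc, hfA⟩ := Submodule.exists_le_ker_of_notMem hcV
  have hcover : ∀ x, f (x - p₀) ≠ 0 → x ∈ b := by
    intro x hx
    obtain ⟨T, hT, hTc⟩ := exists_linearEquiv_fixing_ker f hfc hx
    let σ : Equiv.Perm (Fin n → ℚ) := T.toEquiv.trans (Equiv.addRight (p₀ - T p₀))
    have hσ : ∀ y, σ y = T y + (p₀ - T p₀) := fun y => rfl
    have hσ' : ∀ y, σ y = T (y - p₀) + p₀ := fun y => by rw [hσ, map_sub]; abel
    have hfix : ∀ i, σ (a i) = a i := fun i => by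
      have hi : f (a i - p₀) = 0 := hfA (AffineSubspace.vsub_mem_direction (haA i) hp₀)
      rw [hσ', hT _ hi, sub_add_cancel]
    have hσb : σ '' b = b := hB.eq_of_common_points (hpres σ ⟨T, _, hσ⟩ b hb) hb ha
      (fun i => ⟨a i, hab i, hfix i⟩) hab
    rw [← hσb]
    exact ⟨c, hc, by rw [hσ', hTc, sub_add_cancel]⟩
  obtain ⟨p, hp⟩ := (Set.ne_univ_iff_exists_notMem b).mp (hB.ne_univ hb)
  have hfp : f (p - p₀) = 0 := by
    by_contra h
    exact hp (hcover p h)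
  have hline : ∀ t : ℚ, t ≠ 0 → p + t • (c - p₀) ∈ b := by
    intro t ht
    apply hcover
    rw [add_sub_right_comm, map_add, hfp, map_smul, zero_add, smul_eq_mul]
    exact mul_ne_zero ht hfc
  let τ : Equiv.Perm (Fin n → ℚ) := Equiv.addRight (-(c - p₀))
  have hτ : ∀ x, τ x = x + -(c - p₀) := fun x => rfl
  have hne : c - p₀ ≠ 0 := fun h => hfc (by rw [h, map_zero])
  have hτb : τ '' b = b := by
    refine hB.eq_of_common_points (hpres τ ⟨LinearEquiv.refl ℚ _, _, hτ⟩ b hb) hb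
      (f := fun i : Fin k => p + ((i : ℕ) + 1 : ℚ) • (c - p₀)) ?_ (fun i => ?_) (fun i => ?_)
    · intro i j hij
      have h := smul_left_injective ℚ hne (add_left_cancel hij)
      exact Fin.ext (by exact_mod_cast add_right_cancel h)
    · refine ⟨p + ((i : ℕ) + 2 : ℚ) • (c - p₀), hline _ (by positivity), ?_⟩
      rw [hτ]
      module
    · exact hline _ (by positivity)
  apply hp
  rw [← hτb]
  refine ⟨p + (1 : ℚ) • (c - p₀), hline 1 one_ne_zero, ?_⟩
  rw [hτ]
  module
end

section
/- Let n ≥ 2 and k ≥ 2, and let (ℚ^n, B) be a Steiner k-system preserved by AGL_n(ℚ). Then every block b ∈ B has at least k + 2 elements. -/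
/-- In a Steiner `k`-system, each `k`-element set of points lies in exactly one block. -/
lemma IsSteinerSystem.existsUnique_block {X : Type*} {k : ℕ} {B : Set (Set X)}
    (hB : IsSteinerSystem k B) (S : Finset X) (hS : S.card = k) :
    ∃! b, b ∈ B ∧ (S : Set X) ⊆ b := by
  let g := (S.equivFinOfCardEq hS).symm
  obtain ⟨b, ⟨hbB, hb⟩, huniq⟩ := hB.2.2.2 (fun i => (g i : X))
    (Subtype.val_injective.comp g.injective)
  refine ⟨b, ⟨hbB, fun x hx => ?_⟩, fun c hc => huniq c ⟨hc.1, fun i => hc.2 (g i).2⟩⟩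
  simpa using hb (g.symm ⟨x, hx⟩)

/-- If all blocks have `k + 1` elements and `x ↦ -x` preserves the blocks, then a `k`-element set
stable under negation omits `0` and becomes a block once `0` is added. -/
lemma IsSteinerSystem.insert_zero_mem_of_neg_mem {n k : ℕ} {B : Set (Set (Fin n → ℚ))}
    (hB : IsSteinerSystem k B) (hcard : ∀ b ∈ B, b.encard = k + 1)
    (hneg : ∀ b ∈ B, (fun x => -x) '' b ∈ B)
    (S : Finset (Fin n → ℚ)) (hS : S.card = k) (hsymm : ∀ x ∈ S, -x ∈ S) :
    0 ∉ S ∧ insert 0 (S : Set (Fin n → ℚ)) ∈ B := by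
  obtain ⟨b, ⟨hbB, hSb⟩, huniq⟩ := hB.existsUnique_block S hS
  have hb_neg : (fun x => -x) '' b = b :=
    huniq _ ⟨hneg b hbB, fun x hx => ⟨-x, hSb (hsymm x hx), neg_neg x⟩⟩
  have hdiff : (b \ S).encard = 1 := by
    have h := Set.encard_sdiff_add_encard_of_subset hSb
    rw [Set.encard_coe_eq_coe_finsetCard, hS, hcard b hbB, add_comm] at h
    exact WithTop.add_left_cancel (ENat.natCast_ne_top k) h
  obtain ⟨p, hp⟩ := Set.encard_eq_one.mp hdiff
  have hpb : p ∈ b \ S := hp ▸ rfl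
  have hnp : -p ∈ b \ S :=
    ⟨hb_neg ▸ ⟨p, hpb.1, rfl⟩, fun h => hpb.2 (by simpa using hsymm _ h)⟩
  rw [hp, Set.mem_singleton_iff] at hnp
  obtain rfl : p = 0 := self_eq_neg.mp hnp.symm
  refine ⟨hpb.2, ?_⟩
  have hb : insert 0 (S : Set (Fin n → ℚ)) = b := by
    rw [Set.insert_eq, ← hp, Set.sdiff_union_of_subset hSb]
  exact hb ▸ hbB

/-- The embedding of the integers as the constant vectors of `ℚ^n`. -/
def diagInt (n : ℕ) [NeZero n] : ℤ ↪ (Fin n → ℚ) where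
  toFun z := fun _ => (z : ℚ)
  inj' a b h := by simpa using congrFun h 0

@[simp] lemma diagInt_apply (n : ℕ) [NeZero n] (z : ℤ) (i : Fin n) : diagInt n z i = z := rfl

/-- If `AGL_n(ℚ)` (`n ≥ 2`) preserves a Steiner `k`-system (`k ≥ 2`) on `ℚ^n`,
then every block has at least `k + 2` elements. -/
theorem steiner_block_card_ge_k_add_two (n k : ℕ) (hn : 2 ≤ n) (hk : 2 ≤ k)
    (B : Set (Set (Fin n → ℚ))) (hB : IsSteinerSystem k B)
    (hpres : ∀ σ : Equiv.Perm (Fin n → ℚ), IsAGL n σ → ∀ b ∈ B, σ '' b ∈ B) :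
    ∀ b ∈ B, ((k : Cardinal) + 2) ≤ Cardinal.mk b := by
  by_contra! hlt
  obtain ⟨b₀, hb₀, hb₀lt⟩ := hlt
  have : NeZero n := ⟨by omega⟩
  have hcard : ∀ b ∈ B, b.encard = k + 1 := by
    intro b hb
    have h1 : (k : Cardinal) < Cardinal.mk b := hB.2.1 b hb
    have h2 : Cardinal.mk b < (k : Cardinal) + 2 := hB.1 b₀ hb₀ b hb ▸ hb₀lt
    obtain ⟨m, hm⟩ := Cardinal.lt_aleph0.mp
      (h2.trans (by exact_mod_cast Cardinal.natCast_lt_aleph0 (n := k + 2)))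
    rw [hm] at h1 h2
    norm_cast at h1 h2
    obtain rfl : m = k + 1 := by omega
    simp [Set.encard, ENat.card, hm]
  have hneg : ∀ b ∈ B, (fun x => -x) '' b ∈ B := fun b hb =>
    hpres (Equiv.neg _) ⟨LinearEquiv.neg ℚ, 0, fun x => by simp⟩ b hb
  have hdiag_neg : ∀ z, diagInt n (-z) = -diagInt n z := fun z => by ext; simp
  have hdiag_add : ∀ z, diagInt n (z + 1) = diagInt n z + 1 := fun z => by ext; simp
  have hdiag_zero : diagInt n 0 = 0 := by ext; simp
  obtain ⟨m, rfl | rfl⟩ := Nat.even_or_odd' k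
  · have hS := hB.insert_zero_mem_of_neg_mem hcard hneg
      (((Finset.Icc (-m : ℤ) m).erase 0).map (diagInt n))
      (by
        rw [Finset.card_map, Finset.card_erase_of_mem (by simp), Int.card_Icc]
        omega)
      (by
        intro x hx
        obtain ⟨z, hz, rfl⟩ := Finset.mem_map.mp hx
        refine Finset.mem_map.mpr ⟨-z, ?_, hdiag_neg z⟩
        simp only [Finset.mem_erase, Finset.mem_Icc] at hz ⊢
        omega)
    have hb : diagInt n '' Set.Icc (-m : ℤ) m ∈ B := by
      convert hS.2 using 1
      rw [← Finset.coe_insert, ← hdiag_zero, ← Finset.map_insert,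
        Finset.insert_erase (by simp)]
      simp
    have hb' : diagInt n '' Set.Icc (-m + 1 : ℤ) (m + 1) ∈ B := by
      convert hpres (Equiv.addRight 1) ⟨LinearEquiv.refl ℚ _, 1, fun x => rfl⟩ _ hb using 1
      rw [← Set.image_add_const_Icc, Set.image_image, Set.image_image]
      exact Set.image_congr fun z _ => hdiag_add z
    have heq := (hB.existsUnique_block ((Finset.Icc (-m + 1 : ℤ) m).map (diagInt n))
      (by rw [Finset.card_map, Int.card_Icc]; omega)).unique
      ⟨hb, by
        rw [Finset.coe_map, Finset.coe_Icc]
        exact Set.image_mono (Set.Icc_subset_Icc (by omega) le_rfl)⟩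
      ⟨hb', by
        rw [Finset.coe_map, Finset.coe_Icc]
        exact Set.image_mono (Set.Icc_subset_Icc le_rfl (by omega))⟩
    have hmem : (-m : ℤ) ∈ Set.Icc (-m + 1 : ℤ) (m + 1) :=
      (diagInt n).injective.image_injective heq ▸ Set.mem_Icc.mpr ⟨le_rfl, by omega⟩
    have := hmem.1
    omega
  · refine (hB.insert_zero_mem_of_neg_mem hcard hneg
      ((Finset.Icc (-m : ℤ) m).map (diagInt n))
      (by rw [Finset.card_map, Int.card_Icc]; omega)
      fun x hx => ?_).1 (Finset.mem_map.mpr ⟨0, by simp, hdiag_zero⟩)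
    obtain ⟨z, hz, rfl⟩ := Finset.mem_map.mp hx
    refine Finset.mem_map.mpr ⟨-z, ?_, hdiag_neg z⟩
    simp only [Finset.mem_Icc] at hz ⊢
    omega
end

section
/- Let G be a group acting on a set X, let (J, ≤) be a linear order with no greatest element, and let (Π_i)_{i ∈ J} be a strictly increasing chain of subsets of X (i < j implies Π_i ⊊ Π_j) such that for every g ∈ G there exists i₀ ∈ J such that for every i > i₀ there is j ∈ J with g(Π_i) = Π_j. Then for every g ∈ G there exists i₀ ∈ J such that for every i > i₀, either g⁻¹(Π_i) ⊆ Π_i or g(Π_i) ⊆ Π_i. -/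
open scoped Pointwise

/-- If `G` acts on `X`, `(J, ≤)` is a linear order with no greatest element, and
`(P i)_{i ∈ J}` is a strictly increasing chain of subsets of `X` such that every
`g ∈ G` eventually maps members of the chain to members of the chain, then for
every `g ∈ G`, for all `i` large enough, `g⁻¹(P i) ⊆ P i` or `g(P i) ⊆ P i`. -/
theorem eventually_inv_subset_or_subset {G X : Type*} [Group G] [MulAction G X]
    {J : Type*} [LinearOrder J] (hJ : ∀ i : J, ∃ j, i < j)
    (P : J → Set X) (hmono : ∀ i j : J, i < j → P i ⊂ P j)
    (h : ∀ g : G, ∃ i₀ : J, ∀ i, i₀ < i → ∃ j, g • P i = P j) :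
    ∀ g : G, ∃ i₀ : J, ∀ i, i₀ < i → g⁻¹ • P i ⊆ P i ∨ g • P i ⊆ P i := by
  intro g
  obtain ⟨i₀, hi₀⟩ := h g
  refine ⟨i₀, fun i hi => ?_⟩
  obtain ⟨j, hj⟩ := hi₀ i hi
  have hP : Monotone P := (show StrictMono P from fun i j hij => hmono i j hij).monotone
  rcases le_total i j with hij | hji
  · left
    rw [Set.smul_set_subset_iff_subset_inv_smul_set, inv_inv, hj]
    exact hP hij
  · right
    rw [hj]
    exact hP hji
end
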